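/- There exists an absolute constant B > 0 such that for every ⋆ ∈ {full, new, min}, every even integer k ≥ 2, and every real x ≥ 3, the number of integers N ≥ 1 satisfying min{ ψ^⋆(N), (12/(k−1))·d_k^⋆(N) } ≤ x and ( ω(N) > 3·log log x or N is a perfect square ) is at most B·x/log x, where ω(N) is the number of distinct prime divisors of N. -/

import Mathlib

noncomputable section

/-- Value at `N` of the multiplicative function determined by local values `f p e`
on prime powers `p^e` (`e ≥ 1`). -/
def mval (f : ℕ → ℕ → ℝ) (N : ℕ) : ℝ := ∏ p ∈ N.primeFactors, f p (N.factorization p)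

def psiFull : ℕ → ℝ := mval fun p e => (p:ℝ)^e + (p:ℝ)^(e-1)

def nuInfFull : ℕ → ℝ := mval fun p e =>
  if Odd e then 2*(p:ℝ)^((e-1)/2) else (p:ℝ)^(e/2) + (p:ℝ)^(e/2-1)

def nu2Full : ℕ → ℝ := mval fun p e =>
  if p^e = 2 then 1 else if p % 4 = 1 then 2 else 0

def nu3Full : ℕ → ℝ := mval fun p e =>
  if p^e = 3 then 1 else if p % 3 = 1 then 2 else 0

def psiNew : ℕ → ℝ := mval fun p e =>
  if e = 1 then (p:ℝ)-1
  else if e = 2 then (p:ℝ)^2-(p:ℝ)-1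
  else (p:ℝ)^(e-3)*((p:ℝ)-1)^2*((p:ℝ)+1)

def nuInfNew : ℕ → ℝ := mval fun p e =>
  if e = 2 then (p:ℝ)-2
  else if Even e ∧ 2 < e then (p:ℝ)^(e/2-2)*((p:ℝ)-1)^2
  else 0

def nu2New : ℕ → ℝ := mval fun p e =>
  if p % 4 = 3 ∧ e = 1 then -2
  else if (p % 4 = 3 ∧ e = 2) ∨ p^e = 8 then 1
  else if (p % 4 = 1 ∧ e = 2) ∨ p^e = 2 ∨ p^e = 4 then -1
  else 0

def nu3New : ℕ → ℝ := mval fun p e =>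
  if p % 3 = 2 ∧ e = 1 then -2
  else if (p % 3 = 2 ∧ e = 2) ∨ p^e = 27 then 1
  else if (p % 3 = 1 ∧ e = 2) ∨ p^e = 3 ∨ p^e = 9 then -1
  else 0

def psiMin : ℕ → ℝ := mval fun p e =>
  ((p:ℝ)-1)/((Nat.gcd (Nat.gcd 2 (p-1)) e : ℕ) : ℝ)
    * (if e = 1 then 1 else if e = 2 then (p:ℝ)-1 else (p:ℝ)^(e-3)*((p:ℝ)^2-1))

def nuInfMin : ℕ → ℝ := mval fun p e =>
  if p = 2 ∧ Even e ∧ 2 < e then (2:ℝ)^(e/2-2) else 0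

def nu2Min : ℕ → ℝ := mval fun p e =>
  if p % 4 = 3 then -2*((ArithmeticFunction.moebius (p^(e-1)) : ℤ) : ℝ)
  else if p^e = 2 ∨ p^e = 4 then -1
  else if p^e = 8 then 1
  else 0

def nu3Min : ℕ → ℝ := mval fun p e =>
  if p % 3 = 2 ∧ p^e ≠ 4 then -2*((ArithmeticFunction.moebius (p^(e-1)) : ℤ) : ℝ)
  else if p^e = 3 ∨ p^e = 9 then -1
  else if p^e = 4 ∨ p^e = 27 then 1
  else 0

/-- The Kronecker symbol `(−4|n)`, i.e. the nontrivial character mod 4. -/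
def chi4 (n : ℕ) : ℝ := if n % 4 = 1 then 1 else if n % 4 = 3 then -1 else 0

/-- The Kronecker symbol `(−3|n)`, i.e. the nontrivial character mod 3. -/
def chi3 (n : ℕ) : ℝ := if n % 3 = 1 then 1 else if n % 3 = 2 then -1 else 0

def c2 (k : ℕ) : ℝ := -(1/4) * chi4 (k-1)

def c3 (k : ℕ) : ℝ := -(1/3) * chi3 (k-1)

def delta2 (k : ℕ) : ℝ := if k = 2 then 1 else 0

def dFull (k N : ℕ) : ℝ :=
  ((k:ℝ)-1)/12 * psiFull N - 1/2 * nuInfFull N + c2 k * nu2Full N + c3 k * nu3Full N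
    + delta2 k

def dNew (k N : ℕ) : ℝ :=
  ((k:ℝ)-1)/12 * psiNew N - 1/2 * nuInfNew N + c2 k * nu2New N + c3 k * nu3New N
    + delta2 k * ((ArithmeticFunction.moebius N : ℤ) : ℝ)

def dMin (k N : ℕ) : ℝ :=
  ((k:ℝ)-1)/12 * psiMin N - 1/2 * nuInfMin N + c2 k * nu2Min N + c3 k * nu3Min N
    + delta2 k * ((ArithmeticFunction.moebius N : ℤ) : ℝ)

/-- `ω(N)`: the number of distinct prime divisors of `N`. -/
def omega (N : ℕ) : ℕ := N.primeFactors.card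

/-- A positive integer is squarefull if `p² ∣ N` for every prime `p ∣ N`. -/
def Squarefull (n : ℕ) : Prop := ∀ p : ℕ, p.Prime → p ∣ n → p^2 ∣ n

/-- `H(N)`: the largest squarefull divisor of `N`. -/
def squarefullPart (N : ℕ) : ℕ := sSup {d : ℕ | d ∣ N ∧ Squarefull d}

/-- `η = ζ(3/2)/ζ(3)`. -/
def eta : ℝ := (riemannZeta (3/2) / riemannZeta 3).re

/-- Ford's coefficients `a_n = (n+1)log(n+1) − n log n − 1`. -/
def fordA (n : ℕ) : ℝ := ((n:ℝ)+1)*Real.log ((n:ℝ)+1) - (n:ℝ)*Real.log n - 1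


def loglog (x : ℝ) : ℝ := Real.log (Real.log x)

def logloglog (x : ℝ) : ℝ := Real.log (Real.log (Real.log x))

def loglogloglog (x : ℝ) : ℝ := Real.log (Real.log (Real.log (Real.log x)))

end


/-- local factor of `psiMin` -/
noncomputable def gl (p e : ℕ) : ℝ :=
  ((p:ℝ)-1)/((Nat.gcd (Nat.gcd 2 (p-1)) e : ℕ) : ℝ)
    * (if e = 1 then 1 else if e = 2 then (p:ℝ)-1 else (p:ℝ)^(e-3)*((p:ℝ)^2-1))

lemma psiMin_eq : psiMin = mval gl := rfl

lemma gl_one (p : ℕ) : gl p 1 = (p:ℝ) - 1 := by simp [gl]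

lemma gl_two (e : ℕ) (he : 2 ≤ e) : 1 ≤ gl 2 e ∧ (2:ℝ)^e ≤ 5 * gl 2 e := by
  obtain rfl | he := he.eq_or_lt
  · norm_num [gl]
  · obtain ⟨m, rfl⟩ : ∃ m, e = m + 3 := ⟨e - 3, by omega⟩
    have h1 : (1:ℝ) ≤ 2 ^ m := one_le_pow₀ (by norm_num)
    have : gl 2 (m+3) = 2^m * 3 := by
      simp [gl]; norm_num
    rw [this, pow_add]
    constructor <;> nlinarith

lemma gl_odd (p e : ℕ) (hp : 3 ≤ p) (he : 2 ≤ e) : 1 ≤ gl p e ∧ (p:ℝ)^e ≤ 5 * gl p e := by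
  have hp' : (3:ℝ) ≤ p := by exact_mod_cast hp
  set g := Nat.gcd (Nat.gcd 2 (p-1)) e with hg
  have hgpos : 0 < g := Nat.gcd_pos_of_pos_right _ (by omega)
  have hg2 : g ≤ 2 := by
    refine Nat.le_of_dvd (by norm_num) ((Nat.gcd_dvd_left _ _).trans (Nat.gcd_dvd_left _ _))
  have hdiv : ((p:ℝ)-1)/2 ≤ ((p:ℝ)-1)/(g:ℝ) := by
    apply div_le_div_of_nonneg_left <;> first | linarith | exact_mod_cast hgpos | exact_mod_cast hg2
  obtain rfl | he := he.eq_or_lt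
  · have : ((p:ℝ)-1)/2 * (p-1) ≤ gl p 2 := by
      simp only [gl]
      rw [if_neg (by norm_num)]
      simp only [if_true]
      apply mul_le_mul_of_nonneg_right hdiv; linarith
    constructor
    · nlinarith
    · nlinarith
  · obtain ⟨m, rfl⟩ : ∃ m, e = m + 3 := ⟨e - 3, by omega⟩
    have h1 : (1:ℝ) ≤ (p:ℝ) ^ m := one_le_pow₀ (by linarith)
    have : ((p:ℝ)-1)/2 * ((p:ℝ)^m * ((p:ℝ)^2-1)) ≤ gl p (m+3) := by
      simp only [gl]
      rw [if_neg (by omega), if_neg (by omega)]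
      simp only [Nat.add_sub_cancel]
      apply mul_le_mul_of_nonneg_right hdiv
      apply mul_nonneg (by linarith); nlinarith
    have h2 : 2 * (p:ℝ)^3 ≤ 5 * (((p:ℝ)-1) * ((p:ℝ)^2-1)) := by
      nlinarith [mul_nonneg (sq_nonneg (p:ℝ)) (sub_nonneg.2 hp')]
    have h3 : (2:ℝ) ≤ ((p:ℝ)-1) * ((p:ℝ)^2-1) := by nlinarith
    constructor
    · nlinarith
    · rw [pow_add]
      nlinarith

lemma gl_ge_one (p e : ℕ) (hp : p.Prime) (he : 1 ≤ e) : 1 ≤ gl p e := by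
  obtain rfl | he := he.eq_or_lt
  · rw [gl_one]
    have : (2:ℝ) ≤ p := by exact_mod_cast hp.two_le
    linarith
  · obtain h | h := hp.two_le.eq_or_lt
    · subst h; exact (gl_two e he).1
    · exact (gl_odd p e h he).1

lemma gl_ge_pow (p e : ℕ) (hp : p.Prime) (he : 2 ≤ e) : (p:ℝ)^e ≤ 5 * gl p e := by
  obtain h | h := hp.two_le.eq_or_lt
  · subst h; exact_mod_cast (gl_two e he).2
  · exact (gl_odd p e h he).2

lemma mval_mono (f g : ℕ → ℕ → ℝ) 
    (h0 : ∀ p e, p.Prime → 1 ≤ e → 0 ≤ f p e)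
    (h1 : ∀ p e, p.Prime → 1 ≤ e → f p e ≤ g p e) (N : ℕ) :
    mval f N ≤ mval g N := by
  unfold mval
  apply Finset.prod_le_prod
  · intro p hp
    exact h0 p _ (Nat.prime_of_mem_primeFactors hp) (Nat.Prime.factorization_pos_of_dvd
      (Nat.prime_of_mem_primeFactors hp) (Nat.mem_primeFactors.1 hp).2.2 (Nat.dvd_of_mem_primeFactors hp))
  · intro p hp
    exact h1 p _ (Nat.prime_of_mem_primeFactors hp) (Nat.Prime.factorization_pos_of_dvd
      (Nat.prime_of_mem_primeFactors hp) (Nat.mem_primeFactors.1 hp).2.2 (Nat.dvd_of_mem_primeFactors hp))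

lemma mval_nonneg (f : ℕ → ℕ → ℝ) (h0 : ∀ p e, p.Prime → 1 ≤ e → 0 ≤ f p e) (N : ℕ) :
    0 ≤ mval f N := by
  unfold mval
  apply Finset.prod_nonneg
  intro p hp
  exact h0 p _ (Nat.prime_of_mem_primeFactors hp) (Nat.Prime.factorization_pos_of_dvd
      (Nat.prime_of_mem_primeFactors hp) (Nat.mem_primeFactors.1 hp).2.2 (Nat.dvd_of_mem_primeFactors hp))

lemma mval_mul_fun (f g : ℕ → ℕ → ℝ) (N : ℕ) :
    mval (fun p e => f p e * g p e) N = mval f N * mval g N := by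
  simp [mval, Finset.prod_mul_distrib]

lemma mval_pow_fun (f : ℕ → ℕ → ℝ) (m N : ℕ) :
    mval (fun p e => f p e ^ m) N = mval f N ^ m := by
  simp [mval, Finset.prod_pow]

lemma mval_id (N : ℕ) (hN : N ≠ 0) : mval (fun p e => (p:ℝ)^e) N = N := by
  unfold mval
  conv_rhs => rw [← Nat.prod_factorization_pow_eq_self hN]
  simp [Finsupp.prod]

lemma mval_le (f g : ℕ → ℕ → ℝ) (K : ℝ) (P : ℕ) (hK : 1 ≤ K)
    (h0 : ∀ p e, p.Prime → 1 ≤ e → 0 ≤ f p e)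
    (h0' : ∀ p e, p.Prime → 1 ≤ e → 0 ≤ g p e)
    (h1 : ∀ p e, p.Prime → 1 ≤ e → f p e ≤ K * g p e)
    (h2 : ∀ p e, p.Prime → 1 ≤ e → P ≤ p → f p e ≤ g p e) :
    ∃ C : ℝ, 1 ≤ C ∧ ∀ N, mval f N ≤ C * mval g N := by
  refine ⟨K ^ P, one_le_pow₀ hK, fun N => ?_⟩
  calc mval f N ≤ mval (fun p e => (if p < P then K else 1) * g p e) N := by
        apply mval_mono _ _ h0
        intro p e hp he
        split_ifs with h
        · exact h1 p e hp he
        · rw [one_mul]; exact h2 p e hp he (not_lt.1 h)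
    _ = mval (fun p e => if p < P then K else 1) N * mval g N := mval_mul_fun _ _ _
    _ ≤ K^P * mval g N := by
        apply mul_le_mul_of_nonneg_right _ (mval_nonneg _ h0' _)
        unfold mval
        rw [← Finset.prod_filter, Finset.prod_const]
        apply pow_le_pow_right₀ hK
        calc _ ≤ (Finset.range P).card := by
              apply Finset.card_le_card
              intro p hp
              simp at hp ⊢
              exact hp.2
          _ = P := Finset.card_range _

lemma mval_coprime (f : ℕ → ℕ → ℝ) (a b : ℕ) (h : Nat.Coprime a b) :
    mval f (a*b) = mval f a * mval f b := by
  unfold mval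
  rw [h.primeFactors_mul, Finset.prod_union h.disjoint_primeFactors]
  congr 1
  · apply Finset.prod_congr rfl
    intro p hp
    rw [Nat.factorization_eq_of_coprime_left h (by simpa using hp)]
  · apply Finset.prod_congr rfl
    intro p hp
    rw [Nat.factorization_eq_of_coprime_right h (by simpa using hp)]

/-- local factor of the error term -/
noncomputable def hl (p e : ℕ) : ℝ := 2 * (p:ℝ)^(e/2)

lemma gl_nonneg (p e : ℕ) (hp : p.Prime) (he : 1 ≤ e) : 0 ≤ gl p e :=
  zero_le_one.trans (gl_ge_one p e hp he)

lemma psiMin_ge_one (N : ℕ) : 1 ≤ psiMin N := by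
  rw [psiMin_eq]
  have := mval_mono (fun _ _ => 1) gl (fun _ _ _ _ => zero_le_one) gl_ge_one N
  simpa [mval] using this

lemma key4 : ∃ C : ℝ, 1 ≤ C ∧ ∀ N, mval hl N ^ 4 ≤ C * psiMin N ^ 3 := by
  obtain ⟨C, hC, h⟩ := mval_le (fun p e => hl p e ^ 4) (fun p e => gl p e ^ 3) 2000 2000 (by norm_num)
    (fun p e _ _ => by positivity) (fun p e hp he => pow_nonneg (gl_nonneg p e hp he) 3)
    (by
      intro p e hp he
      have hg := gl_ge_one p e hp he
      have hp1 : (1:ℝ) ≤ p := by exact_mod_cast hp.one_le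
      obtain rfl | he := he.eq_or_lt
      · norm_num [hl]
        nlinarith [one_le_pow₀ hg (n := 3)]
      · have h1 := gl_ge_pow p e hp he
        have h2 : hl p e ^ 4 ≤ 16 * ((p:ℝ)^e)^2 := by
          rw [hl, mul_pow, ← pow_mul, ← pow_mul]
          norm_num
          exact pow_le_pow_right₀ hp1 (by omega)
        have h3 : (1:ℝ) ≤ (p:ℝ)^e := one_le_pow₀ hp1
        have h4 : ((p:ℝ)^e)^3 ≤ (5 * gl p e)^3 := pow_le_pow_left₀ (by linarith) h1 3
        nlinarith [pow_pos (by linarith : 0 < (p:ℝ)^e) 2])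
    (by
      intro p e hp he hP
      have hg := gl_ge_one p e hp he
      have hP' : (2000:ℝ) ≤ p := by exact_mod_cast hP
      have hp1 : (1:ℝ) ≤ p := by exact_mod_cast hp.one_le
      obtain rfl | he := he.eq_or_lt
      · norm_num [hl, gl_one]
        have : (3:ℝ)^3 ≤ ((p:ℝ)-1)^3 := pow_le_pow_left₀ (by norm_num) (by linarith) 3
        linarith
      · have h1 := gl_ge_pow p e hp he
        have h2 : hl p e ^ 4 ≤ 16 * ((p:ℝ)^e)^2 := by
          rw [hl, mul_pow, ← pow_mul, ← pow_mul]
          norm_num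
          exact pow_le_pow_right₀ hp1 (by omega)
        have h3 : (2000:ℝ) ≤ (p:ℝ)^e := hP'.trans (le_self_pow₀ hp1 (by omega))
        have h4 : ((p:ℝ)^e)^3 ≤ (5 * gl p e)^3 := pow_le_pow_left₀ (by linarith) h1 3
        nlinarith [pow_pos (by linarith : 0 < (p:ℝ)^e) 2])
  refine ⟨C, hC, fun N => ?_⟩
  have := h N
  rwa [mval_pow_fun, mval_pow_fun, ← psiMin_eq] at this

lemma key5 : ∃ C : ℝ, 1 ≤ C ∧ ∀ N : ℕ, N ≠ 0 → (N:ℝ) ^ 3 ≤ C * psiMin N ^ 4 := by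
  obtain ⟨C, hC, h⟩ := mval_le (fun p e => ((p:ℝ)^e) ^ 3) (fun p e => gl p e ^ 4) 625 625 (by norm_num)
    (fun p e _ _ => by positivity) (fun p e hp he => by positivity)
    (by
      intro p e hp he
      have hg := gl_ge_one p e hp he
      have hp1 : (2:ℝ) ≤ p := by exact_mod_cast hp.two_le
      obtain rfl | he := he.eq_or_lt
      · rw [gl_one] at *
        have : (p:ℝ)^3 ≤ (2*((p:ℝ)-1))^3 := pow_le_pow_left₀ (by linarith) (by linarith) 3
        norm_num
        nlinarith [pow_pos (by linarith : 0 < (p:ℝ)-1) 3]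
      · have h1 := gl_ge_pow p e hp he
        have h3 : (1:ℝ) ≤ (p:ℝ)^e := one_le_pow₀ (by linarith)
        have h4 : ((p:ℝ)^e)^4 ≤ (5 * gl p e)^4 := pow_le_pow_left₀ (by linarith) h1 4
        nlinarith [pow_pos (by linarith : 0 < (p:ℝ)^e) 3])
    (by
      intro p e hp he hP
      have hg := gl_ge_one p e hp he
      have hP' : (625:ℝ) ≤ p := by exact_mod_cast hP
      obtain rfl | he := he.eq_or_lt
      · rw [gl_one] at *
        have : (p:ℝ)^3 ≤ (2*((p:ℝ)-1))^3 := pow_le_pow_left₀ (by linarith) (by linarith) 3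
        norm_num
        nlinarith [pow_pos (by linarith : 0 < (p:ℝ)-1) 3]
      · have h1 := gl_ge_pow p e hp he
        have h3 : (625:ℝ) ≤ (p:ℝ)^e := hP'.trans (le_self_pow₀ (by linarith) (by omega))
        have h4 : ((p:ℝ)^e)^4 ≤ (5 * gl p e)^4 := pow_le_pow_left₀ (by linarith) h1 4
        nlinarith [pow_pos (by linarith : 0 < (p:ℝ)^e) 3])
  refine ⟨C, hC, fun N hN => ?_⟩
  have := h N
  rwa [mval_pow_fun, mval_pow_fun, ← psiMin_eq, mval_id N hN] at this

lemma key3 : ∃ C : ℝ, 1 ≤ C ∧ ∀ N : ℕ, N ≠ 0 → (N:ℝ) ^ 4 ≤ C * (psiMin N ^ 4 * 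
    ((∏ p ∈ N.primeFactors, (1 + 1/√(p:ℝ))) *
      ∏ p ∈ N.primeFactors with 2 ≤ N.factorization p, (1 + √(p:ℝ)))) := by
  obtain ⟨C, hC, h⟩ := mval_le (fun p e => ((p:ℝ)^e) ^ 4)
    (fun p e => gl p e ^ 4 * ((1 + 1/√(p:ℝ)) * (if 2 ≤ e then 1 + √(p:ℝ) else 1))) 625 400000 (by norm_num)
    (fun p e _ _ => by positivity) (fun p e hp he => by positivity)
    (by
      intro p e hp he
      have hg := gl_ge_one p e hp he
      have hp1 : (2:ℝ) ≤ p := by exact_mod_cast hp.two_le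
      have hs : 0 ≤ 1/√(p:ℝ) := by positivity
      obtain rfl | he := he.eq_or_lt
      · rw [gl_one] at *
        have : (p:ℝ)^4 ≤ (2*((p:ℝ)-1))^4 := pow_le_pow_left₀ (by linarith) (by linarith) 4
        have hs : 0 ≤ (√(p:ℝ))⁻¹ := by positivity
        norm_num
        have h5 := pow_pos (by linarith : 0 < (p:ℝ)-1) 4
        nlinarith [mul_nonneg h5.le hs]
      · have h1 := gl_ge_pow p e hp he
        have h3 : (1:ℝ) ≤ (p:ℝ)^e := one_le_pow₀ (by linarith)
        have h4 : ((p:ℝ)^e)^4 ≤ (5 * gl p e)^4 := pow_le_pow_left₀ (by linarith) h1 4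
        rw [if_pos (by omega)]
        have h5 : 1 ≤ (1 + 1/√(p:ℝ)) * (1 + √(p:ℝ)) := by
          nlinarith [Real.sqrt_nonneg p, mul_nonneg hs (Real.sqrt_nonneg p)]
        nlinarith [pow_pos (by linarith : 0 < gl p e) 4])
    (by
      intro p e hp he hP
      have hg := gl_ge_one p e hp he
      have hP' : (400000:ℝ) ≤ p := by exact_mod_cast hP
      have hs : 0 ≤ 1/√(p:ℝ) := by positivity
      have hS : 624 ≤ √(p:ℝ) := by
        apply Real.le_sqrt_of_sq_le; norm_num; linarith
      obtain rfl | he := he.eq_or_lt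
      · rw [gl_one] at *
        norm_num
        obtain ⟨s, hs⟩ : ∃ s, s = √(p:ℝ) := ⟨_, rfl⟩
        have hps : (p:ℝ) = s^2 := by rw [hs, Real.sq_sqrt (by linarith)]
        rw [← hs] at hS ⊢
        rw [hps]
        have h1 : s⁻¹ * s = 1 := inv_mul_cancel₀ (by linarith)
        have h2 : s^8 - 4 * s^6 ≤ (s^2-1)^4 := by nlinarith [sq_nonneg (s^2)]
        have h3 : (s^2)^4 * s ≤ (s^2-1)^4 * (s+1) := by
          have : (s^8 - 4*s^6) * (s+1) ≤ (s^2-1)^4 * (s+1) :=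
            mul_le_mul_of_nonneg_right h2 (by linarith)
          have h6 : 0 ≤ s^6 * (s^2-4*s-4) := mul_nonneg (by positivity) (by nlinarith)
          nlinarith
        have h4 : (s^2-1)^4 * (1+s⁻¹) = (s^2-1)^4 * (s+1) / s := by field_simp
        rw [h4, le_div_iff₀ (by linarith)]
        exact h3
      · have h1 := gl_ge_pow p e hp he
        have h3 : (1:ℝ) ≤ (p:ℝ)^e := one_le_pow₀ (by linarith)
        have h4 : ((p:ℝ)^e)^4 ≤ (5 * gl p e)^4 := pow_le_pow_left₀ (by linarith) h1 4
        rw [if_pos (by omega)]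
        have h5 : 625 ≤ (1 + 1/√(p:ℝ)) * (1 + √(p:ℝ)) := by
          nlinarith [mul_nonneg hs (Real.sqrt_nonneg p)]
        nlinarith [pow_pos (by linarith : 0 < gl p e) 4])
  refine ⟨C, hC, fun N hN => ?_⟩
  have := h N
  rw [mval_pow_fun, mval_mul_fun, mval_mul_fun, mval_pow_fun, ← psiMin_eq, mval_id N hN] at this
  rw [Finset.prod_filter]
  exact this

lemma prod_one_add_le (S : Finset ℕ) (hS : ∀ p ∈ S, p.Prime) (f : ℕ → ℝ) (hf : ∀ n, 0 ≤ f n)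
    (hmul : ∀ T ⊆ S, ∏ p ∈ T, f p = f (∏ p ∈ T, p)) (D : Finset ℕ)
    (hD : ∀ T ⊆ S, ∏ p ∈ T, p ∈ D) : ∏ p ∈ S, (1 + f p) ≤ ∑ d ∈ D, f d := by
  rw [Finset.prod_one_add]
  calc ∑ T ∈ S.powerset, ∏ p ∈ T, f p = ∑ T ∈ S.powerset, f (∏ p ∈ T, p) := by
        apply Finset.sum_congr rfl
        intro T hT
        exact hmul T (Finset.mem_powerset.1 hT)
    _ = ∑ d ∈ S.powerset.image (fun T => ∏ p ∈ T, p), f d := by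
        rw [Finset.sum_image]
        intro T hT U hU h
        have hT' := Finset.mem_powerset.1 hT
        have hU' := Finset.mem_powerset.1 hU
        rw [← Nat.primeFactors_prod (fun p hp => hS p (hT' hp)),
          ← Nat.primeFactors_prod (fun p hp => hS p (hU' hp))]
        exact congrArg _ h
    _ ≤ ∑ d ∈ D, f d := by
        apply Finset.sum_le_sum_of_subset_of_nonneg
        · intro d hd
          obtain ⟨T, hT, rfl⟩ := Finset.mem_image.1 hd
          exact hD T (Finset.mem_powerset.1 hT)
        · intro i _ _; exact hf i

lemma sqrt_prod_nat (T : Finset ℕ) : ∏ p ∈ T, √(p:ℝ) = √((∏ p ∈ T, p : ℕ):ℝ) := by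
  induction T using Finset.induction_on with
  | empty => simp
  | insert a s ha ih =>
    rw [Finset.prod_insert ha, Finset.prod_insert ha, ih, Nat.cast_mul, Real.sqrt_mul (Nat.cast_nonneg _)]

lemma D1_le (N Z : ℕ) (hN : N ≠ 0) (hZ : N ≤ Z) : ∏ p ∈ N.primeFactors, (1 + 1/√(p:ℝ)) ≤
    ∑ d ∈ Finset.Icc 1 Z with d ∣ N, 1/√(d:ℝ) := by
  apply prod_one_add_le _ (fun p hp => Nat.prime_of_mem_primeFactors hp) (fun d => 1/√(d:ℝ))
  · intro n; positivity
  · intro T _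
    simp only [one_div, Finset.prod_inv_distrib]
    rw [sqrt_prod_nat]
  · intro T hT
    have h : ∏ p ∈ T, p ∣ N :=
      (Finset.prod_dvd_prod_of_subset _ _ _ hT).trans (Nat.prod_primeFactors_dvd N)
    simp only [Finset.mem_filter, Finset.mem_Icc]
    exact ⟨⟨Nat.pos_of_dvd_of_pos h (by omega), (Nat.le_of_dvd (by omega) h).trans hZ⟩, h⟩

lemma D2_le (N Z : ℕ) (hN : N ≠ 0) (hZ : N ≤ Z) :
    ∏ p ∈ N.primeFactors with 2 ≤ N.factorization p, (1 + √(p:ℝ)) ≤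
    ∑ d ∈ Finset.Icc 1 Z with d^2 ∣ N, √(d:ℝ) := by
  apply prod_one_add_le _ (fun p hp => Nat.prime_of_mem_primeFactors (Finset.mem_filter.1 hp).1)
    (fun d => √(d:ℝ))
  · intro n; positivity
  · intro T _
    exact sqrt_prod_nat T
  · intro T hT
    have h : (∏ p ∈ T, p)^2 ∣ N := by
      rw [← Finset.prod_pow]
      apply Finset.prod_dvd_of_isRelPrime
      rotate_left
      · intro p hp
        have := Finset.mem_filter.1 (hT hp)
        exact ((Nat.prime_of_mem_primeFactors this.1).pow_dvd_iff_le_factorization hN).2 this.2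
      · intro p hp q hq hpq
        have h1 := Nat.prime_of_mem_primeFactors (Finset.mem_filter.1 (hT hp)).1
        have h2 := Nat.prime_of_mem_primeFactors (Finset.mem_filter.1 (hT hq)).1
        exact Nat.coprime_iff_isRelPrime.1 (Nat.Coprime.pow 2 2 ((Nat.coprime_primes h1 h2).2 hpq))
    have h' := (dvd_pow_self _ two_ne_zero).trans h
    simp only [Finset.mem_filter, Finset.mem_Icc]
    exact ⟨⟨Nat.pos_of_dvd_of_pos h' (by omega), (Nat.le_of_dvd (by omega) h').trans hZ⟩, h⟩

lemma tail_aux (a M : ℕ) (ha : 1 ≤ a) : ∑ m ∈ Finset.Ioc a M, 1/(m:ℝ)^2 ≤ 1/(a:ℝ) := by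
  have h : ∀ M, a ≤ M → ∑ m ∈ Finset.Ioc a M, 1/(m:ℝ)^2 ≤ 1/(a:ℝ) - 1/(M:ℝ) := by
    intro M hM
    induction M, hM using Nat.le_induction with
    | base => simp
    | succ n hn ih =>
      rw [← Finset.insert_Ioc_right_eq_Ioc_add_one (by omega), Finset.sum_insert (by simp)]
      have hn' : (1:ℝ) ≤ n := by exact_mod_cast ha.trans hn
      have : 1/((n+1:ℕ):ℝ)^2 ≤ 1/(n:ℝ) - 1/((n+1:ℕ):ℝ) := by
        push_cast
        rw [div_sub_div _ _ (by linarith) (by linarith), div_le_div_iff₀ (by positivity) (by positivity)]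
        nlinarith
      linarith
  rcases le_or_gt a M with hM | hM
  · have := h M hM
    have : 0 ≤ 1/(M:ℝ) := by positivity
    linarith
  · rw [Finset.Ioc_eq_empty (by omega)]; simp

lemma tail_sum (t : ℝ) (ht : 0 < t) (M : ℕ) :
    ∑ m ∈ Finset.Icc 1 M with t < (m:ℕ), 1/(m:ℝ)^2 ≤ 2/t := by
  rcases lt_or_ge t 1 with h1 | h1
  · calc _ ≤ ∑ m ∈ insert 1 (Finset.Ioc 1 M), 1/(m:ℝ)^2 := by
          apply Finset.sum_le_sum_of_subset_of_nonneg
          · intro m hm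
            simp at hm ⊢; omega
          · intro i _ _; positivity
      _ ≤ 1 + 1 := by
          rw [Finset.sum_insert (by simp)]
          have := tail_aux 1 M le_rfl
          norm_num at this ⊢; linarith
      _ ≤ 2/t := by
          rw [le_div_iff₀ ht]; linarith
  · have hf : 1 ≤ ⌊t⌋₊ := Nat.one_le_floor_iff _ |>.2 h1
    calc _ ≤ ∑ m ∈ Finset.Ioc ⌊t⌋₊ M, 1/(m:ℝ)^2 := by
          apply Finset.sum_le_sum_of_subset_of_nonneg
          · intro m hm
            simp only [Finset.mem_filter, Finset.mem_Icc, Finset.mem_Ioc] at hm ⊢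
            exact ⟨(Nat.floor_lt ht.le).2 hm.2, hm.1.2⟩
          · intro i _ _; positivity
      _ ≤ 1/(⌊t⌋₊:ℝ) := tail_aux _ _ hf
      _ ≤ 2/t := by
          have := Nat.lt_floor_add_one t
          have h2 : (1:ℝ) ≤ ⌊t⌋₊ := by exact_mod_cast hf
          rw [div_le_div_iff₀ (by linarith) ht]
          linarith

lemma tail_mult (w : ℝ) (hw : 0 < w) (c Z : ℕ) (hc : 1 ≤ c) :
    ∑ n ∈ Finset.Icc 1 Z with w < (n:ℕ) ∧ c ∣ n, 1/(n:ℝ)^2 ≤ 2/(c*w) := by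
  have hc' : (0:ℝ) < c := by exact_mod_cast hc
  calc _ ≤ ∑ n ∈ (Finset.Icc 1 Z |>.filter (fun m : ℕ => w/c < (m:ℝ))).image (fun m => c*m), 1/(n:ℝ)^2 := by
        apply Finset.sum_le_sum_of_subset_of_nonneg
        · intro n hn
          simp only [Finset.mem_filter, Finset.mem_Icc, Finset.mem_image] at hn ⊢
          obtain ⟨⟨h1, h2⟩, h3, m, rfl⟩ := hn
          refine ⟨m, ⟨⟨Nat.pos_of_mul_pos_left h1, ?_⟩, ?_⟩, rfl⟩
          · nlinarith
          · rw [div_lt_iff₀ hc']; push_cast at h3; linarith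
        · intro i _ _; positivity
    _ = ∑ m ∈ Finset.Icc 1 Z with w/c < (m:ℕ), 1/((c*m:ℕ):ℝ)^2 := by
        rw [Finset.sum_image]
        intro a _ b _ h
        exact Nat.eq_of_mul_eq_mul_left hc h
    _ = 1/(c:ℝ)^2 * ∑ m ∈ Finset.Icc 1 Z with w/c < (m:ℕ), 1/(m:ℝ)^2 := by
        rw [Finset.mul_sum]
        apply Finset.sum_congr rfl
        intro m _
        push_cast
        rw [mul_pow, one_div_mul_one_div]
    _ ≤ 1/(c:ℝ)^2 * (2/(w/c)) := by
        apply mul_le_mul_of_nonneg_left _ (by positivity)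
        exact tail_sum _ (by positivity) _
    _ = 2/(c*w) := by field_simp

lemma sum32 : ∃ S : ℝ, 0 ≤ S ∧ ∀ Z : ℕ, ∑ d ∈ Finset.Icc 1 Z, 1/((d:ℝ)*√(d:ℝ)) ≤ S := by
  have h : Summable (fun d : ℕ => 1/((d:ℝ)*√(d:ℝ))) := by
    have := Real.summable_one_div_nat_rpow (p := 3/2) |>.2 (by norm_num)
    refine this.congr ?_
    intro d
    congr 1
    rcases Nat.eq_zero_or_pos d with h | h
    · subst h; simp
    · have : (0:ℝ) < d := by exact_mod_cast h
      rw [Real.sqrt_eq_rpow, show (3/2:ℝ) = 1 + 1/2 by norm_num, Real.rpow_add this, Real.rpow_one]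
  refine ⟨_, tsum_nonneg (fun d => by positivity), fun Z => h.sum_le_tsum _ (fun d _ => by positivity)⟩

/-- the numbers with `psiMin N ≤ y` up to `Z` -/
noncomputable def FF (Z : ℕ) (y : ℝ) : Finset ℕ := (Finset.Icc 1 Z).filter (fun n => psiMin n ≤ y)

lemma swap_sum (Z : ℕ) (w : ℝ) (hw : 0 < w) (c : ℕ → ℕ) (hc : ∀ d, 1 ≤ d → 1 ≤ c d) (f : ℕ → ℝ)
    (hf : ∀ d, 0 ≤ f d) (S : ℝ)
    (hS : ∑ d ∈ Finset.Icc 1 Z, f d / (c d) ≤ S) :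
    ∑ n ∈ Finset.Icc 1 Z with w < (n:ℕ), (1/(n:ℝ)^2) * ∑ d ∈ Finset.Icc 1 Z with c d ∣ n, f d
      ≤ 2 / w * S := by
  calc _ = ∑ n ∈ Finset.Icc 1 Z with w < (n:ℕ), ∑ d ∈ Finset.Icc 1 Z, 
          if c d ∣ n then (1/(n:ℝ)^2) * f d else 0 := by
        apply Finset.sum_congr rfl
        intro n _
        rw [Finset.mul_sum, Finset.sum_filter]
    _ = ∑ d ∈ Finset.Icc 1 Z, f d * ∑ n ∈ Finset.Icc 1 Z with w < (n:ℕ) ∧ c d ∣ n, 1/(n:ℝ)^2 := by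
        rw [Finset.sum_comm]
        apply Finset.sum_congr rfl
        intro d _
        rw [← Finset.sum_filter, Finset.filter_filter, Finset.mul_sum]
        apply Finset.sum_congr rfl
        intro n _; ring
    _ ≤ ∑ d ∈ Finset.Icc 1 Z, f d * (2/(c d * w)) := by
        apply Finset.sum_le_sum
        intro d hd
        apply mul_le_mul_of_nonneg_left _ (hf d)
        exact tail_mult w hw _ Z (hc d (Finset.mem_Icc.1 hd).1)
    _ = 2/w * ∑ d ∈ Finset.Icc 1 Z, f d / (c d) := by
        rw [Finset.mul_sum]
        apply Finset.sum_congr rfl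
        intro d _
        rw [mul_div_assoc', div_mul_div_comm]
        ring
    _ ≤ 2/w*S := mul_le_mul_of_nonneg_left hS (by positivity)

lemma count_lin : ∃ C : ℝ, 1 ≤ C ∧ ∀ Z : ℕ, ∀ w : ℝ, 0 < w → ((FF Z w).card : ℝ) ≤ C * w := by
  obtain ⟨C, hC, h⟩ := key3
  obtain ⟨S, hS0, hS⟩ := sum32
  refine ⟨1 + C * (4 * S), by nlinarith [mul_nonneg (by linarith : (0:ℝ) ≤ C) hS0], fun Z w hw => ?_⟩
  set D1 : ℕ → ℝ := fun n => ∑ d ∈ Finset.Icc 1 Z with d ∣ n, 1/√(d:ℝ) with hD1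
  set D2 : ℕ → ℝ := fun n => ∑ d ∈ Finset.Icc 1 Z with d^2 ∣ n, √(d:ℝ) with hD2
  have hpt : ∀ n ∈ Finset.Icc 1 Z, psiMin n ≤ w → 1 ≤ w^2 * C * ((1/(n:ℝ)^2) * (D1 n + D2 n)) := by
    intro n hn hw'
    obtain ⟨hn1, hnZ⟩ := Finset.mem_Icc.1 hn
    have h1 := h n (by omega)
    have hg := psiMin_ge_one n
    have a1 := D1_le n Z (by omega) hnZ
    have a2 := D2_le n Z (by omega) hnZ
    have b1 : 0 ≤ D1 n := Finset.sum_nonneg (fun _ _ => by positivity)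
    have b2 : 0 ≤ D2 n := Finset.sum_nonneg (fun _ _ => by positivity)
    have hn' : (0:ℝ) < n := by exact_mod_cast hn1
    have h2 : (n:ℝ)^4 ≤ C * (w^4 * (D1 n * D2 n)) := by
      refine h1.trans ?_
      gcongr
    have h3 : ((n:ℝ)^2)^2 ≤ (w^2*C*(D1 n + D2 n))^2 := by
      calc ((n:ℝ)^2)^2 = (n:ℝ)^4 := by ring
        _ ≤ _ := h2
        _ ≤ C^2 * (w^4 * (D1 n + D2 n)^2) := by
            gcongr
            · nlinarith
            · nlinarith
        _ = _ := by ring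
    have h4 : (n:ℝ)^2 ≤ w^2*C*(D1 n + D2 n) :=
      (pow_le_pow_iff_left₀ (by positivity) (by positivity) two_ne_zero).1 h3
    have : w^2 * C * ((1/(n:ℝ)^2) * (D1 n + D2 n)) = w^2*C*(D1 n + D2 n)/(n:ℝ)^2 := by ring
    rw [this, le_div_iff₀ (by positivity)]; linarith
  have hsub : FF Z w ⊆ Finset.Icc 1 ⌊w⌋₊ ∪ (FF Z w).filter (fun n : ℕ => w < (n:ℝ)) := by
    intro n hn
    have hn' := (Finset.mem_filter.1 hn).1
    simp only [Finset.mem_union, Finset.mem_filter, Finset.mem_Icc] at hn' ⊢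
    rcases le_or_gt (n:ℝ) w with h | h
    · left; exact ⟨hn'.1, Nat.le_floor h⟩
    · right; exact ⟨hn, h⟩
  have hcard : ((FF Z w).card : ℝ) ≤ ⌊w⌋₊ + ((FF Z w).filter (fun n : ℕ => w < (n:ℝ))).card := by
    have := (Finset.card_le_card hsub).trans (Finset.card_union_le _ _)
    simp only [Nat.card_Icc, Nat.add_sub_cancel] at this
    exact_mod_cast this
  have hfl := Nat.floor_le hw.le
  have hmain : (((FF Z w).filter (fun n : ℕ => w < (n:ℝ))).card : ℝ) ≤ C * (4 * S) * w := by
    calc (((FF Z w).filter (fun n : ℕ => w < (n:ℝ))).card : ℝ) 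
        = ∑ n ∈ (FF Z w).filter (fun n : ℕ => w < (n:ℝ)), (1:ℝ) := by simp
      _ ≤ ∑ n ∈ (FF Z w).filter (fun n : ℕ => w < (n:ℝ)), w^2 * C * ((1/(n:ℝ)^2) * (D1 n + D2 n)) := by
          apply Finset.sum_le_sum
          intro n hn
          have hn := Finset.mem_filter.1 (Finset.mem_filter.1 hn).1
          exact hpt n hn.1 hn.2
      _ ≤ ∑ n ∈ Finset.Icc 1 Z with w < (n:ℕ), w^2 * C * ((1/(n:ℝ)^2) * (D1 n + D2 n)) := by
          apply Finset.sum_le_sum_of_subset_of_nonneg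
          · exact Finset.filter_subset_filter _ (Finset.filter_subset _ _)
          · intro n _ _
            have b1 : 0 ≤ D1 n := Finset.sum_nonneg (fun _ _ => by positivity)
            have b2 : 0 ≤ D2 n := Finset.sum_nonneg (fun _ _ => by positivity)
            positivity
      _ = w^2 * C * (∑ n ∈ Finset.Icc 1 Z with w < (n:ℕ), (1/(n:ℝ)^2) * D1 n 
            + ∑ n ∈ Finset.Icc 1 Z with w < (n:ℕ), (1/(n:ℝ)^2) * D2 n) := by
          rw [← Finset.sum_add_distrib, Finset.mul_sum]
          apply Finset.sum_congr rfl
          intro n _; ring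
      _ ≤ w^2 * C * (2/w*S + 2/w*S) := by
          gcongr
          · apply swap_sum Z w hw (fun d => d) (fun d hd => hd) _ (fun d => by positivity)
            refine le_trans (le_of_eq ?_) (hS Z)
            apply Finset.sum_congr rfl
            intro d _
            rw [div_div, mul_comm]
          · apply swap_sum Z w hw (fun d => d^2) (fun d hd => Nat.one_le_pow _ _ hd) _ (fun d => by positivity)
            refine le_trans (le_of_eq ?_) (hS Z)
            apply Finset.sum_congr rfl
            intro d hd
            have : (0:ℝ) < d := by exact_mod_cast (Finset.mem_Icc.1 hd).1
            push_cast
            rw [div_eq_div_iff (by positivity) (by positivity)]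
            nlinarith [Real.mul_self_sqrt this.le]
      _ = _ := by field_simp; ring
  linarith

lemma FF_fin : ∃ K : ℝ, 1 ≤ K ∧ ∀ N : ℕ, N ≠ 0 → (N:ℝ) ≤ K * psiMin N ^ 4 := by
  obtain ⟨C, hC, h⟩ := key5
  refine ⟨C, hC, fun N hN => le_trans ?_ (h N hN)⟩
  exact le_self_pow₀ (by exact_mod_cast Nat.one_le_iff_ne_zero.2 hN) (by norm_num)

lemma sum_inv : ∃ C : ℝ, 1 ≤ C ∧ ∀ Z : ℕ, ∀ y : ℝ, 1 ≤ y →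
    ∑ a ∈ FF Z y, 1 / psiMin a ≤ C * (1 + Real.log y) := by
  obtain ⟨C, hC, h⟩ := count_lin
  refine ⟨4 * C, by linarith, fun Z y hy => ?_⟩
  set J := Nat.log 2 ⌊y⌋₊ with hJ
  have hmaps : ∀ a ∈ FF Z y, Nat.log 2 ⌊psiMin a⌋₊ ∈ Finset.range (J+1) := by
    intro a ha
    have := (Finset.mem_filter.1 ha).2
    rw [Finset.mem_range]
    exact Nat.lt_succ_of_le (Nat.log_mono_right (Nat.floor_mono this))
  rw [← Finset.sum_fiberwise_of_maps_to hmaps]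
  have hfib : ∀ j ∈ Finset.range (J+1), 
      ∑ a ∈ FF Z y with Nat.log 2 ⌊psiMin a⌋₊ = j, 1 / psiMin a ≤ 2 * C := by
    intro j _
    have hb : ∀ a, Nat.log 2 ⌊psiMin a⌋₊ = j → (2:ℝ)^j ≤ psiMin a ∧ psiMin a ≤ 2^(j+1) := by
      intro a ha
      have h1 := psiMin_ge_one a
      have hf : ⌊psiMin a⌋₊ ≠ 0 := by
        have := (Nat.one_le_floor_iff _).2 h1; omega
      constructor
      · have := Nat.pow_log_le_self 2 hf
        rw [ha] at this
        have h2 : ((2^j : ℕ):ℝ) ≤ (⌊psiMin a⌋₊:ℝ) := by exact_mod_cast this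
        push_cast at h2
        exact h2.trans (Nat.floor_le (by linarith))
      · have := Nat.lt_pow_succ_log_self (b := 2) (by norm_num) ⌊psiMin a⌋₊
        rw [ha] at this
        have h2 : ((⌊psiMin a⌋₊ + 1 : ℕ):ℝ) ≤ ((2^(j+1) : ℕ):ℝ) := by exact_mod_cast this
        push_cast at h2
        exact (Nat.lt_floor_add_one _).le.trans h2
    calc ∑ a ∈ FF Z y with Nat.log 2 ⌊psiMin a⌋₊ = j, 1 / psiMin a
        ≤ ∑ a ∈ FF Z y with Nat.log 2 ⌊psiMin a⌋₊ = j, 1 / (2:ℝ)^j := by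
          apply Finset.sum_le_sum
          intro a ha
          exact one_div_le_one_div_of_le (by positivity) (hb a (Finset.mem_filter.1 ha).2).1
      _ = ((FF Z y).filter (fun a => Nat.log 2 ⌊psiMin a⌋₊ = j)).card * (1/(2:ℝ)^j) := by simp
      _ ≤ (C * 2^(j+1)) * (1/(2:ℝ)^j) := by
          gcongr
          refine le_trans ?_ (h Z (2^(j+1)) (by positivity))
          exact Nat.cast_le.2 (Finset.card_le_card <| by
            intro a ha
            have := Finset.mem_filter.1 ha
            exact Finset.mem_filter.2 ⟨(Finset.mem_filter.1 this.1).1, (hb a this.2).2⟩)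
      _ = 2 * C := by rw [pow_succ]; field_simp
  refine (Finset.sum_le_sum hfib).trans ?_
  rw [Finset.sum_const, Finset.card_range, nsmul_eq_mul]
  have hJle : (J:ℝ) * Real.log 2 ≤ Real.log y := by
    have hf : ⌊y⌋₊ ≠ 0 := by
      have := (Nat.one_le_floor_iff _).2 hy; omega
    have h1 := Nat.pow_log_le_self 2 hf
    have h2 : ((2^J : ℕ):ℝ) ≤ (⌊y⌋₊:ℝ) := by exact_mod_cast h1
    push_cast at h2
    have h3 := h2.trans (Nat.floor_le (by linarith))
    rw [← Real.log_pow]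
    exact Real.log_le_log (by positivity) h3
  have hl2 := Real.log_two_gt_d9
  have : (J:ℝ) ≤ 2 * Real.log y := by
    have : (0:ℝ) ≤ J := Nat.cast_nonneg _
    nlinarith
  push_cast
  have : ((J:ℝ)+1) * (2*C) ≤ (2*Real.log y + 1) * (2*C) := by gcongr
  nlinarith

lemma primeFactors_prod_pow (N : ℕ) (T : Finset ℕ) (hT : T ⊆ N.primeFactors) :
    (∏ p ∈ T, p ^ N.factorization p).primeFactors = T := by
  ext q
  have hne : ∏ p ∈ T, p ^ N.factorization p ≠ 0 := by
    rw [Finset.prod_ne_zero_iff]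
    intro p hp
    exact pow_ne_zero _ (Nat.prime_of_mem_primeFactors (hT hp)).ne_zero
  rw [Nat.mem_primeFactors]
  constructor
  · rintro ⟨hq, hd, _⟩
    obtain ⟨p, hp, hd⟩ := (hq.prime.dvd_finsetProd_iff _).1 hd
    have := (Nat.prime_dvd_prime_iff_eq hq (Nat.prime_of_mem_primeFactors (hT hp))).1 (hq.dvd_of_dvd_pow hd)
    rwa [this]
  · intro hq
    have hq' := Nat.mem_primeFactors.1 (hT hq)
    refine ⟨hq'.1, ?_, hne⟩
    refine dvd_trans (dvd_pow_self q ?_) (Finset.dvd_prod_of_mem _ hq)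
    exact (hq'.1.factorization_pos_of_dvd hq'.2.2 hq'.2.1).ne'

lemma two_pow_le (Z : ℕ) (y : ℝ) (N : ℕ) (hN : N ∈ FF Z y) :
    2 ^ (omega N) ≤ (((FF Z y) ×ˢ (FF Z y)).filter
      (fun ab : ℕ × ℕ => psiMin ab.1 * psiMin ab.2 ≤ y ∧ ab.1 * ab.2 = N)).card := by
  obtain ⟨hN1, hNy⟩ := Finset.mem_filter.1 hN
  obtain ⟨hN1, hNZ⟩ := Finset.mem_Icc.1 hN1
  rw [omega, ← Finset.card_powerset]
  set A : Finset ℕ → ℕ := fun T => ∏ p ∈ T, p ^ N.factorization p with hA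
  apply Finset.card_le_card_of_injOn (fun T => (A T, A (N.primeFactors \ T)))
  · intro T hT
    have hT' := Finset.mem_powerset.1 hT
    have hmul : A T * A (N.primeFactors \ T) = N := by
      rw [mul_comm, hA]
      simp only
      rw [Finset.prod_sdiff hT']
      conv_rhs => rw [← Nat.prod_factorization_pow_eq_self (n := N) (by omega)]
      rfl
    have hcop : Nat.Coprime (A T) (A (N.primeFactors \ T)) := by
      have h1 : A T ≠ 0 := by rintro h; rw [h] at hmul; omega
      have h2 : A (N.primeFactors \ T) ≠ 0 := by rintro h; rw [h] at hmul; omega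
      rw [← Nat.disjoint_primeFactors h1 h2, primeFactors_prod_pow N T hT',
        primeFactors_prod_pow N _ Finset.sdiff_subset]
      exact Finset.disjoint_sdiff
    have hG : psiMin (A T) * psiMin (A (N.primeFactors \ T)) = psiMin N := by
      rw [psiMin_eq, ← mval_coprime _ _ _ hcop, hmul]
    have g1 := psiMin_ge_one (A T)
    have g2 := psiMin_ge_one (A (N.primeFactors \ T))
    have d1 : A T ∣ N := ⟨_, hmul.symm⟩
    have d2 : A (N.primeFactors \ T) ∣ N := ⟨_, by rw [mul_comm]; exact hmul.symm⟩
    simp only [Finset.coe_filter, Finset.mem_product, Set.mem_ofPred_eq, FF, Finset.mem_filter, Finset.mem_Icc]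
    refine ⟨⟨⟨⟨Nat.pos_of_dvd_of_pos d1 hN1, (Nat.le_of_dvd hN1 d1).trans hNZ⟩, by nlinarith⟩,
      ⟨⟨Nat.pos_of_dvd_of_pos d2 hN1, (Nat.le_of_dvd hN1 d2).trans hNZ⟩, by nlinarith⟩⟩, by linarith, hmul⟩
  · intro T hT U hU h
    have h1 : A T = A U := congrArg Prod.fst h
    rw [← primeFactors_prod_pow N T (Finset.mem_powerset.1 hT),
      ← primeFactors_prod_pow N U (Finset.mem_powerset.1 hU)]
    exact congrArg _ h1

lemma sum_two_pow : ∃ C : ℝ, 1 ≤ C ∧ ∀ Z : ℕ, ∀ y : ℝ, 1 ≤ y →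
    ∑ N ∈ FF Z y, (2:ℝ) ^ (omega N) ≤ C * y * (1 + Real.log y) := by
  obtain ⟨C1, hC1, h1⟩ := count_lin
  obtain ⟨C2, hC2, h2⟩ := sum_inv
  refine ⟨C1 * C2, by nlinarith, fun Z y hy => ?_⟩
  set P := ((FF Z y) ×ˢ (FF Z y)).filter (fun ab : ℕ × ℕ => psiMin ab.1 * psiMin ab.2 ≤ y) with hP
  have hnat : ∑ N ∈ FF Z y, 2 ^ (omega N) ≤ P.card := by
    calc ∑ N ∈ FF Z y, 2 ^ (omega N) ≤ ∑ N ∈ FF Z y, (P.filter (fun ab => ab.1 * ab.2 = N)).card := by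
          apply Finset.sum_le_sum
          intro N hN
          have := two_pow_le Z y N hN
          rwa [← Finset.filter_filter] at this
      _ ≤ P.card := by
          rw [Finset.sum_card_fiberwise_eq_card_filter]
          exact Finset.card_le_card (Finset.filter_subset _ _)
  calc ∑ N ∈ FF Z y, (2:ℝ) ^ (omega N) ≤ (P.card : ℝ) := by exact_mod_cast hnat
    _ ≤ ∑ a ∈ FF Z y, C1 * (y / psiMin a) := by
        have hle : P.card ≤ ∑ a ∈ FF Z y, (FF Z (y / psiMin a)).card := by
          rw [← Finset.card_sigma]
          apply Finset.card_le_card_of_injOn (fun ab => ⟨ab.1, ab.2⟩)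
          · intro ab hab
            have hab := Finset.mem_filter.1 hab
            obtain ⟨ha, hb⟩ := Finset.mem_product.1 hab.1
            have g1 := psiMin_ge_one ab.1
            refine Finset.mem_sigma.2 ⟨ha, Finset.mem_filter.2 ⟨(Finset.mem_filter.1 hb).1, ?_⟩⟩
            show psiMin ab.2 ≤ y / psiMin ab.1
            rw [le_div_iff₀ (by linarith)]
            linarith [hab.2]
          · rintro ⟨a, b⟩ _ ⟨c, d⟩ _ h
            simp at h
            simp [h]
        have hle' : (P.card:ℝ) ≤ ∑ a ∈ FF Z y, ((FF Z (y / psiMin a)).card : ℝ) := by exact_mod_cast hle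
        refine hle'.trans (Finset.sum_le_sum fun a _ => h1 Z _ ?_)
        have g1 := psiMin_ge_one a
        positivity
    _ = C1 * y * ∑ a ∈ FF Z y, 1 / psiMin a := by
        rw [Finset.mul_sum]
        apply Finset.sum_congr rfl
        intro a _; ring
    _ ≤ C1 * y * (C2 * (1 + Real.log y)) := by
        gcongr
        exact h2 Z y hy
    _ = _ := by ring

lemma gl_le_new (p e : ℕ) (hp : p.Prime) (he : 1 ≤ e) : gl p e ≤ 
    (if e = 1 then (p:ℝ)-1
  else if e = 2 then (p:ℝ)^2-(p:ℝ)-1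
  else (p:ℝ)^(e-3)*((p:ℝ)-1)^2*((p:ℝ)+1)) := by
  have hp2 : (2:ℝ) ≤ p := by exact_mod_cast hp.two_le
  have hgpos : 1 ≤ Nat.gcd (Nat.gcd 2 (p-1)) e := Nat.gcd_pos_of_pos_right _ (by omega)
  have hdiv : ((p:ℝ)-1)/((Nat.gcd (Nat.gcd 2 (p-1)) e : ℕ) : ℝ) ≤ (p:ℝ)-1 := by
    apply div_le_self (by linarith)
    exact_mod_cast hgpos
  unfold gl
  split_ifs with h1 h2
  · linarith
  · have := mul_le_mul_of_nonneg_right hdiv (by linarith : 0 ≤ (p:ℝ)-1)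
    nlinarith
  · have h3 : 0 ≤ (p:ℝ)^(e-3)*((p:ℝ)^2-1) := mul_nonneg (by positivity) (by nlinarith)
    have := mul_le_mul_of_nonneg_right hdiv h3
    refine this.trans (le_of_eq ?_)
    ring

lemma new_le_full (p e : ℕ) (hp : p.Prime) (he : 1 ≤ e) :
    (if e = 1 then (p:ℝ)-1
  else if e = 2 then (p:ℝ)^2-(p:ℝ)-1
  else (p:ℝ)^(e-3)*((p:ℝ)-1)^2*((p:ℝ)+1)) ≤ (p:ℝ)^e + (p:ℝ)^(e-1) := by
  have hp2 : (2:ℝ) ≤ p := by exact_mod_cast hp.two_le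
  split_ifs with h1 h2
  · subst h1; norm_num; linarith
  · subst h2; norm_num; linarith
  · obtain ⟨m, rfl⟩ : ∃ m, e = m + 3 := ⟨e - 3, by omega⟩
    have h1 : m + 3 - 1 = m + 2 := by omega
    rw [h1, Nat.add_sub_cancel, pow_add, pow_add]
    have h3 : 0 ≤ (p:ℝ)^m * (p+1) := by positivity
    nlinarith [mul_le_mul_of_nonneg_left (by nlinarith : ((p:ℝ)-1)^2 ≤ p^2) h3]

lemma psiMin_le_new (N : ℕ) : psiMin N ≤ psiNew N :=
  mval_mono _ _ gl_nonneg gl_le_new N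

lemma psiMin_le_full (N : ℕ) : psiMin N ≤ psiFull N :=
  mval_mono _ _ gl_nonneg (fun p e hp he => (gl_le_new p e hp he).trans (new_le_full p e hp he)) N

lemma abs_mval_le (f : ℕ → ℕ → ℝ) (h : ∀ p e, p.Prime → 1 ≤ e → |f p e| ≤ hl p e) (N : ℕ) :
    |mval f N| ≤ mval hl N := by
  have : |mval f N| = mval (fun p e => |f p e|) N := by
    simp [mval, Finset.abs_prod]
  rw [this]
  exact mval_mono _ _ (fun _ _ _ _ => abs_nonneg _) h N

lemma hl_ge_two (p e : ℕ) (hp : p.Prime) : 2 ≤ hl p e := by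
  have hp2 : (1:ℝ) ≤ p := by exact_mod_cast hp.one_le
  have := one_le_pow₀ hp2 (n := e/2)
  unfold hl; linarith

lemma one_le_h (N : ℕ) : 1 ≤ mval hl N := by
  have := mval_mono (fun _ _ => 1) hl (fun _ _ _ _ => zero_le_one)
    (fun p e hp _ => by linarith [hl_ge_two p e hp]) N
  simpa [mval] using this

lemma b_inf_full (N : ℕ) : |nuInfFull N| ≤ mval hl N := by
  apply abs_mval_le
  intro p e hp he
  have hp2 : (2:ℝ) ≤ p := by exact_mod_cast hp.two_le
  split_ifs with h
  · rw [abs_of_nonneg (by positivity), hl]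
    gcongr
    · linarith
    · omega
  · rw [abs_of_nonneg (by positivity), hl]
    have : (p:ℝ)^(e/2-1) ≤ (p:ℝ)^(e/2) := pow_le_pow_right₀ (by linarith) (by omega)
    linarith

lemma b_inf_new (N : ℕ) : |nuInfNew N| ≤ mval hl N := by
  apply abs_mval_le
  intro p e hp he
  have hp2 : (2:ℝ) ≤ p := by exact_mod_cast hp.two_le
  split_ifs with h h'
  · subst h
    rw [abs_of_nonneg (by linarith), hl]
    norm_num; linarith
  · obtain ⟨m, hm⟩ : ∃ m, e/2 = m + 2 := by
      obtain ⟨⟨r, hr⟩, h2⟩ := h'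
      exact ⟨e/2-2, by omega⟩
    rw [abs_of_nonneg (by positivity), hl, hm, Nat.add_sub_cancel, pow_add]
    have : 0 < (p:ℝ)^m := by positivity
    nlinarith [mul_le_mul_of_nonneg_left (by nlinarith : ((p:ℝ)-1)^2 ≤ 2*p^2) this.le]
  · simp; linarith [hl_ge_two p e hp]

lemma b_inf_min (N : ℕ) : |nuInfMin N| ≤ mval hl N := by
  apply abs_mval_le
  intro p e hp he
  split_ifs with h
  · rw [abs_of_nonneg (by positivity), hl, h.1]
    have : (2:ℝ)^(e/2-2) ≤ (2:ℝ)^(e/2) := pow_le_pow_right₀ (by norm_num) (by omega)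
    have h2 : (0:ℝ) < 2^(e/2) := by positivity
    push_cast
    linarith
  · simp; linarith [hl_ge_two p e hp]

lemma b2_full (N : ℕ) : |nu2Full N| ≤ mval hl N := by
  apply abs_mval_le
  intro p e hp he
  have := hl_ge_two p e hp
  split_ifs <;> norm_num <;> linarith

lemma b3_full (N : ℕ) : |nu3Full N| ≤ mval hl N := by
  apply abs_mval_le
  intro p e hp he
  have := hl_ge_two p e hp
  split_ifs <;> norm_num <;> linarith

lemma b2_new (N : ℕ) : |nu2New N| ≤ mval hl N := by
  apply abs_mval_le
  intro p e hp he
  have := hl_ge_two p e hp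
  split_ifs <;> norm_num <;> linarith

lemma b3_new (N : ℕ) : |nu3New N| ≤ mval hl N := by
  apply abs_mval_le
  intro p e hp he
  have := hl_ge_two p e hp
  split_ifs <;> norm_num <;> linarith

lemma abs_mu (n : ℕ) : |((ArithmeticFunction.moebius n : ℤ) : ℝ)| ≤ 1 := by
  have := ArithmeticFunction.abs_moebius_le_one (n := n)
  exact_mod_cast this

lemma b2_min (N : ℕ) : |nu2Min N| ≤ mval hl N := by
  apply abs_mval_le
  intro p e hp he
  have := hl_ge_two p e hp
  split_ifs
  · rw [abs_mul]
    have := abs_mu (p^(e-1))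
    norm_num
    linarith
  all_goals norm_num <;> linarith

lemma b3_min (N : ℕ) : |nu3Min N| ≤ mval hl N := by
  apply abs_mval_le
  intro p e hp he
  have := hl_ge_two p e hp
  split_ifs
  · rw [abs_mul]
    have := abs_mu (p^(e-1))
    norm_num
    linarith
  all_goals norm_num <;> linarith

lemma d_lower (k : ℕ) (hk : 2 ≤ k) (psi a b c d H : ℝ) (ha : |a| ≤ H) (hb : |b| ≤ H) (hc : |c| ≤ H)
    (hd : |d| ≤ H) :
    psi - 25 * H ≤ 12/((k:ℝ)-1) * (((k:ℝ)-1)/12 * psi - 1/2 * a + c2 k * b + c3 k * c + delta2 k * d) := by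
  have hk' : (2:ℝ) ≤ k := by exact_mod_cast hk
  have hH : 0 ≤ H := (abs_nonneg _).trans ha
  have e2 : |c2 k * b| ≤ 1/4 * H := by
    rw [abs_mul]
    apply mul_le_mul _ hb (abs_nonneg _) (by norm_num)
    unfold c2 chi4; split_ifs <;> norm_num
  have e3 : |c3 k * c| ≤ 1/3 * H := by
    rw [abs_mul]
    apply mul_le_mul _ hc (abs_nonneg _) (by norm_num)
    unfold c3 chi3; split_ifs <;> norm_num
  have ed : |delta2 k * d| ≤ 1 * H := by
    rw [abs_mul]
    apply mul_le_mul _ hd (abs_nonneg _) (by norm_num)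
    unfold delta2; split_ifs <;> norm_num
  have h1 : 12/((k:ℝ)-1) ≤ 12 := div_le_self (by norm_num) (by linarith)
  have h2 : 0 ≤ 12/((k:ℝ)-1) := div_nonneg (by norm_num) (by linarith)
  have h3 : 12/((k:ℝ)-1) * (((k:ℝ)-1)/12 * psi) = psi := by
    have : (k:ℝ)-1 ≠ 0 := by linarith
    field_simp
  have h4 : -(25/12*H) ≤ - 1/2 * a + c2 k * b + c3 k * c + delta2 k * d := by
    have := (abs_le.1 ha).2
    have := (abs_le.1 e2).1
    have := (abs_le.1 e3).1
    have := (abs_le.1 ed).1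
    linarith
  have h5 : 12/((k:ℝ)-1) * (25/12*H) ≤ 12 * (25/12*H) := by gcongr
  have h6 := mul_le_mul_of_nonneg_left h4 h2
  have h7 : 12/((k:ℝ)-1) * (((k:ℝ)-1)/12 * psi - 1/2 * a + c2 k * b + c3 k * c + delta2 k * d)
    = 12/((k:ℝ)-1) * (((k:ℝ)-1)/12 * psi) + 12/((k:ℝ)-1) * (- 1/2 * a + c2 k * b + c3 k * c + delta2 k * d) := by ring
  rw [h7, h3]
  linarith

lemma reduce : ∃ C : ℝ, 1 ≤ C ∧ ∀ N : ℕ, ∀ x : ℝ, 3 ≤ x → psiMin N - 25 * mval hl N ≤ x →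
    psiMin N ≤ C * x := by
  obtain ⟨C, hC, h⟩ := key4
  refine ⟨2 + 50^4*C, by nlinarith, fun N x hx hN => ?_⟩
  have hg := psiMin_ge_one N
  have hh := one_le_h N
  rcases le_or_gt (50 * mval hl N) (psiMin N) with h1 | h1
  · nlinarith
  · have h2 : psiMin N ^ 4 ≤ (50 * mval hl N)^4 := pow_le_pow_left₀ (by linarith) h1.le 4
    have h3 : psiMin N ^ 3 * psiMin N ≤ psiMin N ^ 3 * (50^4*C) := by nlinarith [h N]
    have h4 := le_of_mul_le_mul_left h3 (by positivity)
    nlinarith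

lemma master : ∃ B : ℝ, 0 < B ∧ ∀ x : ℝ, 3 ≤ x → ∀ s : Set ℕ,
    (∀ N ∈ s, 1 ≤ N ∧ psiMin N - 25 * mval hl N ≤ x ∧
      (3 * Real.log (Real.log x) < (omega N : ℝ) ∨ IsSquare N)) →
    (Set.ncard s : ℝ) ≤ B * x / Real.log x := by
  obtain ⟨C, hC, hred⟩ := reduce
  obtain ⟨K, hK, hfin⟩ := FF_fin
  obtain ⟨K5, hK5, h5⟩ := key5
  obtain ⟨C2, hC2, hsum⟩ := sum_two_pow
  refine ⟨C2 * C * (2 + Real.log C) + 27 * (K5 * C^4), ?_, fun x hx s hs => ?_⟩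
  · have := Real.log_nonneg hC
    positivity
  have hlog : 1 ≤ Real.log x := by
    rw [Real.le_log_iff_exp_le (by linarith)]
    linarith [Real.exp_one_lt_three]
  have hlC := Real.log_nonneg hC
  set y := C * x with hy
  have hy1 : 1 ≤ y := by nlinarith
  set Z := ⌊K * y^4⌋₊ with hZ
  set E1 := (FF Z y).filter (fun N => 3 * Real.log (Real.log x) < (omega N : ℝ)) with hE1
  set R : ℝ := (27 * (K5 * C^4)) * x / Real.log x with hR
  have hR0 : 0 ≤ R := by positivity
  set E2 := (Finset.Icc 1 ⌊R⌋₊).image (fun m => m * m) with hE2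
  have hsub : s ⊆ ((E1 ∪ E2 : Finset ℕ) : Set ℕ) := by
    intro N hN
    obtain ⟨hN1, hNx, hN3⟩ := hs N hN
    have hg := psiMin_ge_one N
    have hNy : psiMin N ≤ y := hred N x hx hNx
    have hNZ : N ≤ Z := by
      apply Nat.le_floor
      refine (hfin N (by omega)).trans ?_
      gcongr
    rw [Finset.mem_coe, Finset.mem_union]
    rcases hN3 with h | ⟨m, rfl⟩
    · left
      exact Finset.mem_filter.2 ⟨Finset.mem_filter.2 ⟨Finset.mem_Icc.2 ⟨hN1, hNZ⟩, hNy⟩, h⟩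
    · right
      have hm1 : 1 ≤ m := by
        rcases Nat.eq_zero_or_pos m with h | h
        · subst h; omega
        · exact h
      refine Finset.mem_image.2 ⟨m, Finset.mem_Icc.2 ⟨hm1, Nat.le_floor ?_⟩, rfl⟩
      rw [hR, le_div_iff₀ (by linarith)]
      have a1 : ((m:ℝ)^6) ≤ K5 * (C*x)^4 := by
        have := h5 (m*m) (by omega)
        push_cast at this
        calc (m:ℝ)^6 = ((m:ℝ)*m)^3 := by ring
          _ ≤ _ := this
          _ ≤ _ := by gcongr
      have a2 : Real.log x ^ 6 ≤ 27^6 * x^2 := by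
        have h1 := Real.log_le_rpow_div (by linarith : 0 ≤ x) (show (0:ℝ) < 1/3 by norm_num)
        have h2 : Real.log x ^ 6 ≤ (x^(1/3:ℝ)/(1/3))^6 := pow_le_pow_left₀ (by linarith) h1 6
        have h3 : (x^(1/3:ℝ))^6 = x^2 := by
          rw [← Real.rpow_natCast, ← Real.rpow_mul (by linarith), ← Real.rpow_natCast]
          norm_num
        rw [div_pow, h3] at h2
        have : 0 ≤ x^2 := by positivity
        refine h2.trans ?_
        rw [div_eq_mul_inv]
        nlinarith
      have hKC : 1 ≤ K5 * C^4 := by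
        have := one_le_pow₀ hC (n := 4)
        nlinarith
      have a3 : ((m:ℝ) * Real.log x)^6 ≤ (27 * (K5 * C^4) * x)^6 := by
        calc ((m:ℝ) * Real.log x)^6 = (m:ℝ)^6 * Real.log x ^ 6 := by ring
          _ ≤ (K5 * (C*x)^4) * (27^6 * x^2) := by gcongr
          _ = 27^6 * (K5 * C^4) * x^6 := by ring
          _ ≤ 27^6 * (K5 * C^4)^6 * x^6 := by
              gcongr
              exact le_self_pow₀ hKC (by norm_num)
          _ = _ := by ring
      exact (pow_le_pow_iff_left₀ (by positivity) (by positivity) (by norm_num)).1 a3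
  have hcard : (Set.ncard s : ℝ) ≤ E1.card + E2.card := by
    have h1 := Set.ncard_le_ncard hsub (Finset.finite_toSet _)
    rw [Set.ncard_coe_finset] at h1
    exact_mod_cast h1.trans (Finset.card_union_le _ _)
  have hE2c : (E2.card : ℝ) ≤ R := by
    refine le_trans ?_ (Nat.floor_le hR0)
    have : E2.card ≤ _ := Finset.card_image_le
    simp only [Nat.card_Icc, Nat.add_sub_cancel] at this
    exact_mod_cast this
  have hE1c : (E1.card : ℝ) ≤ C2 * C * (2 + Real.log C) * x / Real.log x := by
    have h1 : (E1.card : ℝ) * (Real.log x)^2 ≤ C2 * y * (1 + Real.log y) := by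
      refine le_trans ?_ (hsum Z y hy1)
      calc (E1.card : ℝ) * (Real.log x)^2 = ∑ N ∈ E1, (Real.log x)^2 := by simp
        _ ≤ ∑ N ∈ E1, (2:ℝ)^(omega N) := by
            apply Finset.sum_le_sum
            intro N hN
            have hw := (Finset.mem_filter.1 hN).2
            have hll := Real.log_nonneg hlog
            have hl2 := Real.log_two_gt_d9
            rw [← Real.log_le_log_iff (by positivity) (by positivity), Real.log_pow, Real.log_pow]
            push_cast
            nlinarith
        _ ≤ _ := by
            apply Finset.sum_le_sum_of_subset_of_nonneg (Finset.filter_subset _ _)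
            intro i _ _; positivity
    have h2 : 1 + Real.log y ≤ (2 + Real.log C) * Real.log x := by
      rw [hy, Real.log_mul (by linarith) (by linarith)]
      nlinarith
    rw [le_div_iff₀ (by linarith)]
    have h3 : C2 * y * (1 + Real.log y) ≤ C2 * y * ((2 + Real.log C) * Real.log x) := by gcongr
    have h4 : (E1.card : ℝ) * Real.log x * Real.log x ≤ C2 * C * (2 + Real.log C) * x * Real.log x := by
      rw [hy] at h3
      nlinarith
    exact le_of_mul_le_mul_right h4 (by linarith)
  calc (Set.ncard s : ℝ) ≤ E1.card + E2.card := hcard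
    _ ≤ C2 * C * (2 + Real.log C) * x / Real.log x + R := add_le_add hE1c hE2c
    _ = _ := by rw [hR]; ring

theorem exceptional_count :
    ∃ B : ℝ, 0 < B ∧ ∀ k : ℕ, Even k → 2 ≤ k → ∀ x : ℝ, 3 ≤ x →
      ((Set.ncard {N : ℕ | 1 ≤ N ∧ min (psiFull N) (12/((k:ℝ)-1) * dFull k N) ≤ x ∧ (3 * Real.log (Real.log x) < (omega N : ℝ) ∨ IsSquare N)} : ℝ) ≤ B * x / Real.log x) ∧
      ((Set.ncard {N : ℕ | 1 ≤ N ∧ min (psiNew N) (12/((k:ℝ)-1) * dNew k N) ≤ x ∧ (3 * Real.log (Real.log x) < (omega N : ℝ) ∨ IsSquare N)} : ℝ) ≤ B * x / Real.log x) ∧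
      ((Set.ncard {N : ℕ | 1 ≤ N ∧ min (psiMin N) (12/((k:ℝ)-1) * dMin k N) ≤ x ∧ (3 * Real.log (Real.log x) < (omega N : ℝ) ∨ IsSquare N)} : ℝ) ≤ B * x / Real.log x) := by
  obtain ⟨B, hB, h⟩ := master
  refine ⟨B, hB, fun k _ hk x hx => ⟨?_, ?_, ?_⟩⟩
  · apply h x hx
    rintro N ⟨h1, h2, h3⟩
    refine ⟨h1, le_trans (le_min ?_ ?_) h2, h3⟩
    · linarith [psiMin_le_full N, one_le_h N]
    · have := d_lower k hk (psiFull N) _ _ _ 1 _ (b_inf_full N) (b2_full N) (b3_full N)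
        (by simpa using one_le_h N)
      rw [mul_one] at this
      unfold dFull
      linarith [psiMin_le_full N]
  · apply h x hx
    rintro N ⟨h1, h2, h3⟩
    refine ⟨h1, le_trans (le_min ?_ ?_) h2, h3⟩
    · linarith [psiMin_le_new N, one_le_h N]
    · have := d_lower k hk (psiNew N) _ _ _ _ _ (b_inf_new N) (b2_new N) (b3_new N)
        ((abs_mu N).trans (one_le_h N))
      unfold dNew
      linarith [psiMin_le_new N]
  · apply h x hx
    rintro N ⟨h1, h2, h3⟩
    refine ⟨h1, le_trans (le_min ?_ ?_) h2, h3⟩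
    · linarith [one_le_h N]
    · have := d_lower k hk (psiMin N) _ _ _ _ _ (b_inf_min N) (b2_min N) (b3_min N)
        ((abs_mu N).trans (one_le_h N))
      unfold dMin
      linarith
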